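/- arXiv:0707.3211 — 2 statements merged into one kernel-verified Lean document; each statement's English description precedes it below -/
import Mathlib

section
/- Let (f,φ) be a classical solution of the reformulated Nordström–Vlasov system as in the context. Define the local momentum q_i(t,x) = ∫_{ℝ³} p_i f(t,x,p) dp − ∂_tφ(t,x) ∂_iφ(t,x) and the local stress tensor τ_{ij}(t,x) = ∫_{ℝ³} p_i p_j (e^{2φ(t,x)}+|p|²)^{-1/2} f(t,x,p) dp + ∂_iφ(t,x) ∂_jφ(t,x) + (1/2)δ_{ij}[(∂_tφ(t,x))² − |∇_xφ(t,x)|²]. Then for each i ∈ {1,2,3} the local momentum conservation law ∂_t q_i(t,x) + Σ_{j=1}^{3} ∂_j τ_{ij}(t,x) = 0 holds at every point (t,x) ∈ ℝ×ℝ³. -/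
open MeasureTheory Real

noncomputable section

/-- Euclidean 3-space. -/
abbrev E3 := EuclideanSpace ℝ (Fin 3)

/-- Partial derivative of `g` at `x` in the `i`-th coordinate direction. -/
def pd (g : E3 → ℝ) (x : E3) (i : Fin 3) : ℝ :=
  fderiv ℝ g x (EuclideanSpace.single i 1)

/-- `(f, φ)` is a classical solution of the reformulated Nordström–Vlasov system:
`f` is `C¹` and nonnegative, `φ` is `C²`, the Vlasov equation and the wave equation hold
pointwise, and `f` has locally uniformly compact support in the momentum variable. -/
def NVSystem (f : ℝ → E3 → E3 → ℝ) (φ : ℝ → E3 → ℝ) : Prop :=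
  (ContDiff ℝ 1 (fun w : ℝ × E3 × E3 => f w.1 w.2.1 w.2.2)) ∧
  (∀ t x p, 0 ≤ f t x p) ∧
  (ContDiff ℝ 2 (fun w : ℝ × E3 => φ w.1 w.2)) ∧
  (∀ (t : ℝ) (x p : E3),
    deriv (fun s => f s x p) t
    + (∑ i, (p i / Real.sqrt (Real.exp (2 * φ t x) + ‖p‖ ^ 2)) * pd (fun y => f t y p) x i)
    - (∑ i, pd (fun y => Real.sqrt (Real.exp (2 * φ t y) + ‖p‖ ^ 2)) x i
        * pd (fun w => f t x w) p i) = 0) ∧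
  (∀ (t : ℝ) (x : E3),
    deriv (fun s => deriv (fun s' => φ s' x) s) t - (∑ i, pd (fun y => pd (φ t) y i) x i)
    = - Real.exp (2 * φ t x)
        * ∫ p : E3, f t x p / Real.sqrt (Real.exp (2 * φ t x) + ‖p‖ ^ 2)) ∧
  (∀ K : Set (ℝ × E3), IsCompact K →
    ∃ R > (0 : ℝ), ∀ (t : ℝ) (x p : E3), (t, x) ∈ K → R ≤ ‖p‖ → f t x p = 0)

lemma nv_integrable {g : E3 → ℝ} (hg : Continuous g) (R : ℝ)
    (h : ∀ p : E3, R < ‖p‖ → g p = 0) : Integrable g := by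
  apply hg.integrable_of_hasCompactSupport
  apply HasCompactSupport.intro (isCompact_closedBall (0 : E3) R)
  intro p hp
  apply h
  simpa using hp

lemma nv_fderiv_zero {V : Type*} [NormedAddCommGroup V] [NormedSpace ℝ V]
    {G : V × E3 → ℝ} {w₀ : V} {r R : ℝ}
    (h : ∀ w ∈ Metric.ball w₀ r, ∀ p : E3, R < ‖p‖ → G (w, p) = 0)
    {w : V} (hw : w ∈ Metric.ball w₀ r) {p : E3} (hp : R < ‖p‖) :
    fderiv ℝ G (w, p) = 0 := by
  have : G =ᶠ[nhds (w, p)] fun _ => 0 := by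
    have h1 : ∀ᶠ z in nhds (w, p), z.1 ∈ Metric.ball w₀ r :=
      (continuous_fst.continuousAt (x := (w, p))).eventually (Metric.isOpen_ball.mem_nhds hw)
    have h2 : ∀ᶠ z : V × E3 in nhds (w, p), R < ‖z.2‖ :=
      (continuous_snd.norm.continuousAt (x := (w, p))).eventually (lt_mem_nhds hp)
    filter_upwards [h1, h2] with z hz1 hz2
    exact h z.1 hz1 z.2 hz2
  rw [this.fderiv_eq]
  simp

lemma nv_param {G : (ℝ × E3) × E3 → ℝ} (hG : ContDiff ℝ 1 G) (w₀ : ℝ × E3) (R : ℝ)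
    (h : ∀ w ∈ Metric.ball w₀ 1, ∀ p : E3, R < ‖p‖ → G (w, p) = 0) :
    DifferentiableAt ℝ (fun w => ∫ p, G (w, p)) w₀ ∧
    (∀ v u, Integrable fun p => fderiv ℝ G (w₀, p) (v, u)) ∧
    ∀ v, fderiv ℝ (fun w => ∫ p, G (w, p)) w₀ v = ∫ p, fderiv ℝ G (w₀, p) (v, 0) := by
  have hc : Continuous (fderiv ℝ G) := hG.continuous_fderiv (by norm_num)
  have hd : Differentiable ℝ G := hG.differentiable (by norm_num)
  obtain ⟨M, hM⟩ := ((isCompact_closedBall w₀ 1).prod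
    (isCompact_closedBall (0 : E3) R)).exists_bound_of_continuousOn hc.continuousOn
  let I1 : (ℝ × E3) →L[ℝ] (ℝ × E3) × E3 := ContinuousLinearMap.inl ℝ (ℝ × E3) E3
  let F' : (ℝ × E3) → E3 → (ℝ × E3) →L[ℝ] ℝ := fun w p => (fderiv ℝ G (w, p)).comp I1
  have hw0 : w₀ ∈ Metric.ball w₀ 1 := Metric.mem_ball_self one_pos
  have hF'c : Continuous (F' w₀) := by
    have : Continuous fun p : E3 => fderiv ℝ G (w₀, p) := hc.comp (by fun_prop)
    exact this.clm_comp continuous_const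
  have hF'i : Integrable (F' w₀) := by
    apply hF'c.integrable_of_hasCompactSupport
    apply HasCompactSupport.intro (isCompact_closedBall (0 : E3) R)
    intro p hp
    have hp' : R < ‖p‖ := by simpa using hp
    simp [F', nv_fderiv_zero h hw0 hp']
  have key : HasFDerivAt (fun w => ∫ p, G (w, p)) (∫ p, F' w₀ p) w₀ := by
    apply hasFDerivAt_integral_of_dominated_of_fderiv_le (F' := F')
      (bound := (Metric.closedBall (0 : E3) R).indicator fun _ => M * ‖I1‖)
      (Metric.ball_mem_nhds w₀ one_pos)
    · refine Filter.Eventually.of_forall fun w => ?_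
      exact (hG.continuous.comp (by fun_prop : Continuous fun p : E3 => (w, p))).aestronglyMeasurable
    · exact nv_integrable (hG.continuous.comp (by fun_prop)) R (h w₀ hw0)
    · exact hF'c.aestronglyMeasurable
    · refine Filter.Eventually.of_forall fun p w hw => ?_
      by_cases hp : p ∈ Metric.closedBall (0 : E3) R
      · rw [Set.indicator_of_mem hp]
        refine (ContinuousLinearMap.opNorm_comp_le _ _).trans ?_
        gcongr
        exact hM (w, p) ⟨Metric.ball_subset_closedBall hw, hp⟩
      · rw [Set.indicator_of_notMem hp]
        have hp' : R < ‖p‖ := by simpa using hp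
        simp [F', nv_fderiv_zero h hw hp']
    · rw [integrable_indicator_iff Metric.isClosed_closedBall.measurableSet]
      exact integrableOn_const (isCompact_closedBall _ _).measure_lt_top.ne
    · refine Filter.Eventually.of_forall fun p w _ => ?_
      exact (hd (w, p)).hasFDerivAt.comp w (hasFDerivAt_prodMk_left w p)
  refine ⟨key.differentiableAt, fun v u => ?_, fun v => ?_⟩
  · refine nv_integrable ?_ R fun p hp => by simp [nv_fderiv_zero h hw0 hp]
    have : Continuous fun p : E3 => fderiv ℝ G (w₀, p) := hc.comp (by fun_prop)
    exact this.clm_apply continuous_const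
  · rw [key.fderiv, ContinuousLinearMap.integral_apply hF'i]
    rfl

lemma nv_div_zero {G : (ℝ × E3) × E3 → ℝ} (hG : ContDiff ℝ 1 G) (w₀ : ℝ × E3) (R : ℝ)
    (h : ∀ w ∈ Metric.ball w₀ 1, ∀ p : E3, R < ‖p‖ → G (w, p) = 0) (u : E3) :
    ∫ p, fderiv ℝ G (w₀, p) (0, u) = 0 := by
  have hd : Differentiable ℝ G := hG.differentiable (by norm_num)
  have hw0 : w₀ ∈ Metric.ball w₀ 1 := Metric.mem_ball_self one_pos
  have hi := (nv_param hG w₀ R h).2.1 0 u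
  have h0 : Integrable fun p => G (w₀, p) :=
    nv_integrable (hG.continuous.comp (by fun_prop)) R (h w₀ hw0)
  have := integral_bilinear_hasFDerivAt_right_eq_neg_left_of_integrable (μ := (volume : Measure E3))
    (f := fun _ : E3 => (1 : ℝ)) (f' := fun _ => 0) (g := fun p => G (w₀, p)) (v := u)
    (g' := fun p => (fderiv ℝ G (w₀, p)).comp (ContinuousLinearMap.inr ℝ (ℝ × E3) E3))
    (B := ContinuousLinearMap.mul ℝ ℝ) (by simp) (by simpa using hi) (by simpa using h0)
    (fun p _ => hasFDerivAt_const _ _)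
    (fun p _ => (hd (w₀, p)).hasFDerivAt.comp p (hasFDerivAt_prodMk_right w₀ p))
  simpa using this

lemma nv_dt {g : ℝ × E3 → ℝ} {t : ℝ} {x : E3} (hg : DifferentiableAt ℝ g (t, x)) :
    deriv (fun s => g (s, x)) t = fderiv ℝ g (t, x) (1, 0) := by
  have := (hg.hasFDerivAt.comp t (hasFDerivAt_prodMk_left t x)).hasDerivAt.deriv
  simpa [Function.comp_def] using this

lemma nv_dx {g : ℝ × E3 → ℝ} {t : ℝ} {x : E3} (hg : DifferentiableAt ℝ g (t, x)) (j : Fin 3) :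
    pd (fun y => g (t, y)) x j = fderiv ℝ g (t, x) (0, EuclideanSpace.single j 1) := by
  have := (hg.hasFDerivAt.comp x (hasFDerivAt_prodMk_right t x)).fderiv
  simp only [pd]
  simp only [Function.comp_def] at this
  rw [this]
  simp

/-- relativistic energy -/
def nvS (Φ : ℝ × E3 → ℝ) (z : (ℝ × E3) × E3) : ℝ :=
  Real.sqrt (Real.exp (2 * Φ z.1) + ‖z.2‖ ^ 2)

lemma nvS_pos (Φ : ℝ × E3 → ℝ) (z) : 0 < nvS Φ z := by
  unfold nvS; positivity

lemma nvS_contDiff {Φ : ℝ × E3 → ℝ} (hΦ : ContDiff ℝ 2 Φ) : ContDiff ℝ 1 (nvS Φ) := by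
  have h1 : ContDiff ℝ 1 Φ := hΦ.of_le (by norm_num)
  unfold nvS
  refine ContDiff.sqrt ?_ fun z => by positivity
  exact ((contDiff_const.mul (h1.comp contDiff_fst)).exp).add (contDiff_snd.norm_sq ℝ)

lemma nvS_fderiv {Φ : ℝ × E3 → ℝ} (hΦ : ContDiff ℝ 2 Φ) (z v) :
    fderiv ℝ (nvS Φ) z v =
      (Real.exp (2 * Φ z.1) * fderiv ℝ Φ z.1 v.1 + inner ℝ z.2 v.2) / nvS Φ z := by
  have h1 : Differentiable ℝ Φ := hΦ.differentiable (by norm_num)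
  have hA : HasFDerivAt (fun z : (ℝ × E3) × E3 => Φ z.1)
      ((fderiv ℝ Φ z.1).comp (ContinuousLinearMap.fst ℝ _ _)) z :=
    (h1 z.1).hasFDerivAt.comp z hasFDerivAt_fst
  have hB := ((hA.const_mul 2).exp.add
    ((hasFDerivAt_snd (𝕜 := ℝ) (p := z)).norm_sq)).sqrt
      (ne_of_gt (show (0 : ℝ) < Real.exp (2 * Φ z.1) + ‖z.2‖ ^ 2 by positivity))
  have : fderiv ℝ (nvS Φ) z = _ := hB.fderiv
  rw [this]
  have hp := nvS_pos Φ z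
  simp only [nvS] at hp ⊢
  simp
  field_simp

lemma nvK_contDiff {Φ : ℝ × E3 → ℝ} (hΦ : ContDiff ℝ 2 Φ) {F : (ℝ × E3) × E3 → ℝ}
    (hF : ContDiff ℝ 1 F) {a : E3 → ℝ} (ha : ContDiff ℝ 1 a) :
    ContDiff ℝ 1 (fun z : (ℝ × E3) × E3 => a z.2 / nvS Φ z * F z) :=
  ((ha.comp contDiff_snd).div (nvS_contDiff hΦ) fun z => (nvS_pos Φ z).ne').mul hF

lemma nvK_fderiv {Φ : ℝ × E3 → ℝ} (hΦ : ContDiff ℝ 2 Φ) {F : (ℝ × E3) × E3 → ℝ}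
    (hF : ContDiff ℝ 1 F) {a : E3 → ℝ} (ha : ContDiff ℝ 1 a) (z v) :
    fderiv ℝ (fun z : (ℝ × E3) × E3 => a z.2 / nvS Φ z * F z) z v =
      fderiv ℝ a z.2 v.2 / nvS Φ z * F z
      - a z.2 * (Real.exp (2 * Φ z.1) * fderiv ℝ Φ z.1 v.1 + inner ℝ z.2 v.2) / nvS Φ z ^ 3 * F z
      + a z.2 / nvS Φ z * fderiv ℝ F z v := by
  have hS := ((nvS_contDiff hΦ).differentiable (by norm_num) z).hasFDerivAt
  have hF' := (hF.differentiable (by norm_num) z).hasFDerivAt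
  have hA : HasFDerivAt (fun z : (ℝ × E3) × E3 => a z.2)
      ((fderiv ℝ a z.2).comp (ContinuousLinearMap.snd ℝ _ _)) z :=
    (ha.differentiable (by norm_num) z.2).hasFDerivAt.comp z hasFDerivAt_snd
  have hp := nvS_pos Φ z
  have hinv : HasFDerivAt (fun z => (nvS Φ z)⁻¹) _ z :=
    (hasDerivAt_inv hp.ne').comp_hasFDerivAt z hS
  have h := (hA.mul hinv).mul hF'
  have h' : HasFDerivAt (fun z : (ℝ × E3) × E3 => a z.2 / nvS Φ z * F z) _ z := h
  rw [h'.fderiv]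
  simp [nvS_fderiv hΦ]
  field_simp
  ring

lemma nv_coord_fderiv (i : Fin 3) (p u : E3) : fderiv ℝ (fun p : E3 => p i) p u = u i := by
  have : HasFDerivAt (fun p : E3 => p i) (EuclideanSpace.proj (𝕜 := ℝ) i) p :=
    (EuclideanSpace.proj (𝕜 := ℝ) i).hasFDerivAt
  rw [this.fderiv]; rfl

lemma nv_coord_contDiff (i : Fin 3) : ContDiff ℝ 1 (fun p : E3 => p i) :=
  (EuclideanSpace.proj (𝕜 := ℝ) i : E3 →L[ℝ] ℝ).contDiff

lemma nvQ_fderiv {F : (ℝ × E3) × E3 → ℝ} (hF : ContDiff ℝ 1 F) (i : Fin 3) (z v) :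
    fderiv ℝ (fun z : (ℝ × E3) × E3 => z.2 i * F z) z v = v.2 i * F z + z.2 i * fderiv ℝ F z v := by
  have hF' := (hF.differentiable (by norm_num) z).hasFDerivAt
  have hA : HasFDerivAt (fun z : (ℝ × E3) × E3 => z.2 i)
      ((fderiv ℝ (fun p : E3 => p i) z.2).comp (ContinuousLinearMap.snd ℝ _ _)) z :=
    HasFDerivAt.comp (g := fun p : E3 => p i) z
      ((nv_coord_contDiff i).differentiable (by norm_num) z.2).hasFDerivAt hasFDerivAt_snd
  have h' : HasFDerivAt (fun z : (ℝ × E3) × E3 => z.2 i * F z) _ z := hA.mul hF'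
  rw [h'.fderiv]
  simp [nv_coord_fderiv]
  ring

/-- The kinetic part of the conservation law. -/
lemma nv_kinetic {Φ : ℝ × E3 → ℝ} (hΦ : ContDiff ℝ 2 Φ) {F : (ℝ × E3) × E3 → ℝ}
    (hF : ContDiff ℝ 1 F) (w : ℝ × E3) (R : ℝ)
    (h : ∀ w' ∈ Metric.ball w 1, ∀ p : E3, R < ‖p‖ → F (w', p) = 0)
    (hV : ∀ p : E3, fderiv ℝ F (w, p) ((1, 0), 0)
      + (∑ j, p j / nvS Φ (w, p) * fderiv ℝ F (w, p) ((0, EuclideanSpace.single j 1), 0))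
      - (∑ j, fderiv ℝ (nvS Φ) (w, p) ((0, EuclideanSpace.single j 1), 0)
          * fderiv ℝ F (w, p) (0, EuclideanSpace.single j 1)) = 0) (i : Fin 3) :
    (∫ p, fderiv ℝ (fun z : (ℝ × E3) × E3 => z.2 i * F z) (w, p) ((1, 0), 0))
    + (∑ j, ∫ p, fderiv ℝ (fun z : (ℝ × E3) × E3 => z.2 i * z.2 j / nvS Φ z * F z) (w, p)
        ((0, EuclideanSpace.single j 1), 0))
    + fderiv ℝ Φ w (0, EuclideanSpace.single i 1) * (Real.exp (2 * Φ w)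
      * ∫ p, F (w, p) / nvS Φ (w, p)) = 0 := by
  have hc := nv_coord_contDiff
  have ha : ∀ j, ContDiff ℝ 1 (fun p : E3 => p i * p j) := fun j => (hc i).mul (hc j)
  set c : Fin 3 → ℝ := fun j =>
    Real.exp (2 * Φ w) * fderiv ℝ Φ w (0, EuclideanSpace.single j 1) with hcdef
  have hb : ∀ j, ContDiff ℝ 1 (fun p : E3 => p i * c j) := fun j => (hc i).mul contDiff_const
  have hw : w ∈ Metric.ball w 1 := Metric.mem_ball_self one_pos
  have hQ : ContDiff ℝ 1 (fun z : (ℝ × E3) × E3 => z.2 i * F z) := ((hc i).comp contDiff_snd).mul hF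
  have i1 := (nv_param hQ w R (fun w' hw' p hp => by simp [h w' hw' p hp])).2.1 (1, 0) 0
  have i2 := fun j => (nv_param (nvK_contDiff hΦ hF (ha j)) w R
    (fun w' hw' p hp => by simp [h w' hw' p hp])).2.1 (0, EuclideanSpace.single j 1) 0
  have i3 : Integrable fun p => F (w, p) / nvS Φ (w, p) := by
    refine nv_integrable ?_ R fun p hp => by simp [h w hw p hp]
    have hm : Continuous fun p : E3 => (w, p) := by fun_prop
    exact (hF.continuous.comp hm).div ((nvS_contDiff hΦ).continuous.comp hm)
      fun p => (nvS_pos Φ _).ne'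
  have i4 := fun j => (nv_param (nvK_contDiff hΦ hF (hb j)) w R
    (fun w' hw' p hp => by simp [h w' hw' p hp])).2.1 0 (EuclideanSpace.single j 1)
  have z4 := fun j => nv_div_zero (nvK_contDiff hΦ hF (hb j)) w R
    (fun w' hw' p hp => by simp [h w' hw' p hp]) (EuclideanSpace.single j 1)
  have key : (∫ p, fderiv ℝ (fun z : (ℝ × E3) × E3 => z.2 i * F z) (w, p) ((1, 0), 0))
    + (∑ j, ∫ p, fderiv ℝ (fun z : (ℝ × E3) × E3 => z.2 i * z.2 j / nvS Φ z * F z) (w, p)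
        ((0, EuclideanSpace.single j 1), 0))
    + fderiv ℝ Φ w (0, EuclideanSpace.single i 1) * (Real.exp (2 * Φ w)
      * ∫ p, F (w, p) / nvS Φ (w, p)) = ∑ j, ∫ p, fderiv ℝ
        (fun z : (ℝ × E3) × E3 => z.2 i * c j / nvS Φ z * F z) (w, p)
        (0, EuclideanSpace.single j 1) := by
    have i12 : Integrable fun p =>
        fderiv ℝ (fun z : (ℝ × E3) × E3 => z.2 i * F z) (w, p) ((1, 0), 0)
        + ∑ j, fderiv ℝ (fun z : (ℝ × E3) × E3 => z.2 i * z.2 j / nvS Φ z * F z) (w, p)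
          ((0, EuclideanSpace.single j 1), 0) :=
      i1.add (integrable_finsetSum _ fun j _ => i2 j)
    rw [← integral_const_mul, ← integral_const_mul,
      ← integral_finsetSum _ fun j _ => i2 j, ← integral_finsetSum _ fun j _ => i4 j,
      ← integral_add i1 (integrable_finsetSum _ fun j _ => i2 j),
      ← integral_add i12
        ((i3.const_mul _).const_mul _)]
    congr 1
    ext p
    have hp := nvS_pos Φ (w, p)
    have hv := hV p
    have e1 : ∀ j v, fderiv ℝ (fun z : (ℝ × E3) × E3 => z.2 i * z.2 j / nvS Φ z * F z) (w, p) v = _ :=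
      fun j v => nvK_fderiv hΦ hF (ha j) (w, p) v
    have e2 : ∀ j v, fderiv ℝ (fun z : (ℝ × E3) × E3 => z.2 i * c j / nvS Φ z * F z) (w, p) v = _ :=
      fun j v => nvK_fderiv hΦ hF (hb j) (w, p) v
    have e3 : ∀ j u, fderiv ℝ (fun p : E3 => p i * c j) p u = u i * c j := by
      intro j u
      rw [fderiv_mul_const ((hc i).differentiable (by norm_num) p)]
      simp [nv_coord_fderiv, mul_comm]
    simp only [e1, e2, e3, nvQ_fderiv hF, nvS_fderiv hΦ] at hv ⊢
    have hci : fderiv ℝ Φ w (0, EuclideanSpace.single i 1) * (Real.exp (2 * Φ w)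
      * (F (w, p) / nvS Φ (w, p))) = ∑ j, (EuclideanSpace.single j (1:ℝ) : E3) i * c j
        / nvS Φ (w, p) * F (w, p) := by
      rw [Finset.sum_eq_single i]
      · simp [hcdef]; ring
      · intro b _ hb
        simp [hb.symm]
      · simp
    rw [hci]
    have hv' : fderiv ℝ F (w, p) ((1, 0), 0) =
      - (∑ j, p j / nvS Φ (w, p) * fderiv ℝ F (w, p) ((0, EuclideanSpace.single j 1), 0))
      + ∑ j, c j / nvS Φ (w, p) * fderiv ℝ F (w, p) (0, EuclideanSpace.single j 1) := by
      simp only [inner_zero_right, add_zero] at hv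
      simp only [hcdef]
      linarith
    rw [hv']
    simp only [map_zero, inner_zero_right, EuclideanSpace.inner_single_right, hcdef]
    simp [Fin.sum_univ_three]
    ring
  rw [key]
  exact Finset.sum_eq_zero fun j _ => z4 j
/-- local momentum conservation ∂ₜqᵢ + Σⱼ ∂ⱼτᵢⱼ = 0 for solutions of the
reformulated Nordström–Vlasov system. -/
theorem local_momentum_conservation
    (f : ℝ → E3 → E3 → ℝ) (φ : ℝ → E3 → ℝ) (hsys : NVSystem f φ)
    (qloc : Fin 3 → ℝ → E3 → ℝ) (τ : Fin 3 → Fin 3 → ℝ → E3 → ℝ)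
    (hqloc : ∀ i t x, qloc i t x
      = (∫ p : E3, p i * f t x p) - deriv (fun s => φ s x) t * pd (φ t) x i)
    (hτ : ∀ i j t x, τ i j t x
      = (∫ p : E3, p i * p j / Real.sqrt (Real.exp (2 * φ t x) + ‖p‖ ^ 2) * f t x p)
        + pd (φ t) x i * pd (φ t) x j
        + (1/2) * (if i = j then (1:ℝ) else 0)
            * ((deriv (fun s => φ s x) t) ^ 2 - ∑ l, (pd (φ t) x l) ^ 2)) :
    ∀ (i : Fin 3) (t : ℝ) (x : E3),
      deriv (fun s => qloc i s x) t + ∑ j, pd (fun y => τ i j t y) x j = 0 := by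
  obtain ⟨hf1, -, hφ, hvl, hwave, hsupp⟩ := hsys
  intro i t x
  set Φ : ℝ × E3 → ℝ := fun w => φ w.1 w.2 with hΦdef
  set F : (ℝ × E3) × E3 → ℝ := fun z => f z.1.1 z.1.2 z.2 with hFdef
  have hF : ContDiff ℝ 1 F := hf1.comp
    (show ContDiff ℝ 1 (fun z : (ℝ × E3) × E3 => (z.1.1, z.1.2, z.2)) by fun_prop)
  have hΦd : Differentiable ℝ Φ := hφ.differentiable (by norm_num)
  have hFd : Differentiable ℝ F := hF.differentiable (by norm_num)
  have hSd : Differentiable ℝ (nvS Φ) := (nvS_contDiff hφ).differentiable (by norm_num)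
  obtain ⟨R, -, hR⟩ := hsupp (Metric.closedBall (t, x) 1) (isCompact_closedBall _ _)
  have hR' : ∀ w' ∈ Metric.ball (t, x) 1, ∀ p : E3, R < ‖p‖ → F (w', p) = 0 :=
    fun w' hw' p hp => hR w'.1 w'.2 p (Metric.ball_subset_closedBall hw') hp.le
  -- first derivatives of the field
  have hdt : ∀ s y, deriv (fun s' => φ s' y) s = fderiv ℝ Φ (s, y) (1, 0) :=
    fun s y => nv_dt (g := Φ) (hΦd (s, y))
  have hdx : ∀ s y j, pd (φ s) y j = fderiv ℝ Φ (s, y) (0, EuclideanSpace.single j 1) :=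
    fun s y j => nv_dx (g := Φ) (hΦd (s, y)) j
  -- second derivatives
  have hD1 : ContDiff ℝ 1 (fderiv ℝ Φ) := hφ.fderiv_right (by norm_num)
  set B := fderiv ℝ (fderiv ℝ Φ) (t, x) with hB
  have hBd : ∀ v, HasFDerivAt (fun w => fderiv ℝ Φ w v) (B.flip v) (t, x) := by
    intro v
    have h0 : HasFDerivAt (fderiv ℝ Φ) B (t, x) :=
      (hD1.differentiable (by norm_num) (t, x)).hasFDerivAt
    have := h0.clm_apply (hasFDerivAt_const v (t, x))
    rwa [ContinuousLinearMap.comp_zero, zero_add] at this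
  have hsymm : ∀ v u, B v u = B u v := by
    intro v u
    exact second_derivative_symmetric (fun y => (hΦd y).hasFDerivAt)
      (hD1.differentiable (by norm_num) (t, x)).hasFDerivAt v u
  -- the wave equation
  have hW := hwave t x
  simp only [hdt, hdx] at hW
  rw [nv_dt (g := fun w => fderiv ℝ Φ w (1, 0)) (hBd _).differentiableAt] at hW
  simp only [fun j => nv_dx (g := fun w => fderiv ℝ Φ w (0, EuclideanSpace.single j 1))
    (hBd _).differentiableAt j, (hBd _).fderiv, ContinuousLinearMap.flip_apply] at hW
  -- the Vlasov equation
  have hFl : ∀ (G : (ℝ × E3) × E3 → ℝ) (hG : Differentiable ℝ G) (p : E3) (v),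
      DifferentiableAt ℝ (fun w => G (w, p)) (t, x) ∧
      fderiv ℝ (fun w => G (w, p)) (t, x) v = fderiv ℝ G ((t, x), p) (v, 0) := by
    intro G hG p v
    have h1 : HasFDerivAt (fun w => G (w, p)) _ (t, x) :=
      (hG ((t, x), p)).hasFDerivAt.comp (t, x) (hasFDerivAt_prodMk_left (t, x) p)
    refine ⟨h1.differentiableAt, ?_⟩
    rw [h1.fderiv]
    simp
  have hVl : ∀ p : E3, fderiv ℝ F ((t, x), p) ((1, 0), 0)
      + (∑ j, p j / nvS Φ ((t, x), p)
          * fderiv ℝ F ((t, x), p) ((0, EuclideanSpace.single j 1), 0))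
      - (∑ j, fderiv ℝ (nvS Φ) ((t, x), p) ((0, EuclideanSpace.single j 1), 0)
          * fderiv ℝ F ((t, x), p) (0, EuclideanSpace.single j 1)) = 0 := by
    intro p
    have hv := hvl t x p
    have a1 : deriv (fun s => f s x p) t = fderiv ℝ F ((t, x), p) ((1, 0), 0) := by
      rw [← (hFl F hFd p (1, 0)).2]
      exact nv_dt (g := fun w => F (w, p)) (hFl F hFd p 0).1
    have a2 : ∀ j, pd (fun y => f t y p) x j
        = fderiv ℝ F ((t, x), p) ((0, EuclideanSpace.single j 1), 0) := by
      intro j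
      rw [← (hFl F hFd p _).2]
      exact nv_dx (g := fun w => F (w, p)) (hFl F hFd p 0).1 j
    have a3 : ∀ j, pd (fun y => Real.sqrt (Real.exp (2 * φ t y) + ‖p‖ ^ 2)) x j
        = fderiv ℝ (nvS Φ) ((t, x), p) ((0, EuclideanSpace.single j 1), 0) := by
      intro j
      rw [← (hFl _ hSd p _).2]
      exact nv_dx (g := fun w => nvS Φ (w, p)) (hFl _ hSd p 0).1 j
    have a4 : ∀ j, pd (fun u => f t x u) p j
        = fderiv ℝ F ((t, x), p) (0, EuclideanSpace.single j 1) := by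
      intro j
      have h1 : HasFDerivAt (fun u => f t x u) _ p :=
        (hFd ((t, x), p)).hasFDerivAt.comp p (hasFDerivAt_prodMk_right (t, x) p)
      rw [pd, h1.fderiv]
      simp
    simp only [a1, a2, a3, a4] at hv
    exact hv
  have hkin := nv_kinetic hφ hF (t, x) R hR' hVl i
  have hc := nv_coord_contDiff
  obtain ⟨q1, -, q2⟩ := nv_param (G := fun z => z.2 i * F z)
    (((hc i).comp contDiff_snd).mul hF) (t, x) R
    (fun w' hw' p hp => by simp [hR' w' hw' p hp])
  have hT := fun j => nv_param (G := fun z => z.2 i * z.2 j / nvS Φ z * F z)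
    (nvK_contDiff hφ hF ((hc i).mul (hc j))) (t, x) R
    (fun w' hw' p hp => by simp [hR' w' hw' p hp])
  -- time derivative of the momentum
  have hq : deriv (fun s => qloc i s x) t
      = (∫ p, fderiv ℝ (fun z : (ℝ × E3) × E3 => z.2 i * F z) ((t, x), p) ((1, 0), 0))
        - (fderiv ℝ Φ (t, x) (1, 0) * B (1, 0) (0, EuclideanSpace.single i 1)
          + fderiv ℝ Φ (t, x) (0, EuclideanSpace.single i 1) * B (1, 0) (1, 0)) := by
    have h1 : HasFDerivAt (fun w : ℝ × E3 => (∫ p : E3, p i * F (w, p))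
        - fderiv ℝ Φ w (1, 0) * fderiv ℝ Φ w (0, EuclideanSpace.single i 1)) _ (t, x) :=
      q1.hasFDerivAt.sub ((hBd (1, 0)).mul (hBd (0, EuclideanSpace.single i 1)))
    have h2 : (fun s => qloc i s x) = fun s => (fun w : ℝ × E3 => (∫ p, p i * F (w, p))
        - fderiv ℝ Φ w (1, 0) * fderiv ℝ Φ w (0, EuclideanSpace.single i 1)) (s, x) := by
      ext s
      simp only [hqloc, hdt, hdx, hFdef]
    rw [h2, nv_dt h1.differentiableAt, h1.fderiv, ← q2]
    simp
  -- divergence of the stress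
  have hτd : ∀ j, pd (fun y => τ i j t y) x j
      = (∫ p, fderiv ℝ (fun z : (ℝ × E3) × E3 => z.2 i * z.2 j / nvS Φ z * F z) ((t, x), p)
          ((0, EuclideanSpace.single j 1), 0))
        + (fderiv ℝ Φ (t, x) (0, EuclideanSpace.single i 1)
            * B (0, EuclideanSpace.single j 1) (0, EuclideanSpace.single j 1)
          + fderiv ℝ Φ (t, x) (0, EuclideanSpace.single j 1)
            * B (0, EuclideanSpace.single j 1) (0, EuclideanSpace.single i 1))
        + (if i = j then (1:ℝ) else 0) *
          (fderiv ℝ Φ (t, x) (1, 0) * B (0, EuclideanSpace.single j 1) (1, 0)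
            - ∑ l, fderiv ℝ Φ (t, x) (0, EuclideanSpace.single l 1)
              * B (0, EuclideanSpace.single j 1) (0, EuclideanSpace.single l 1)) := by
    intro j
    have h1 := ((hT j).1.hasFDerivAt.add ((hBd (0, EuclideanSpace.single i 1)).mul
      (hBd (0, EuclideanSpace.single j 1)))).add
      ((((hBd (1, 0)).pow 2).sub (HasFDerivAt.fun_sum (u := Finset.univ) fun l _ =>
        (hBd (0, EuclideanSpace.single l 1)).pow 2)).const_mul
          ((1/2) * (if i = j then (1:ℝ) else 0)))
    have h2 : (fun y => τ i j t y) = fun y => (fun w : ℝ × E3 =>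
        (∫ p, p i * p j / nvS Φ (w, p) * F (w, p))
        + fderiv ℝ Φ w (0, EuclideanSpace.single i 1) * fderiv ℝ Φ w (0, EuclideanSpace.single j 1)
        + (1/2) * (if i = j then (1:ℝ) else 0) * ((fderiv ℝ Φ w (1, 0)) ^ 2
          - ∑ l, (fderiv ℝ Φ w (0, EuclideanSpace.single l 1)) ^ 2)) (t, y) := by
      ext y
      simp only [hτ, hdt, hdx, hFdef, nvS, hΦdef]
    have h3 : HasFDerivAt (fun w : ℝ × E3 =>
        (∫ p, p i * p j / nvS Φ (w, p) * F (w, p))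
        + fderiv ℝ Φ w (0, EuclideanSpace.single i 1) * fderiv ℝ Φ w (0, EuclideanSpace.single j 1)
        + (1/2) * (if i = j then (1:ℝ) else 0) * ((fderiv ℝ Φ w (1, 0)) ^ 2
          - ∑ l, (fderiv ℝ Φ w (0, EuclideanSpace.single l 1)) ^ 2)) _ (t, x) := h1
    rw [h2, nv_dx h3.differentiableAt, h3.fderiv, ← (hT j).2.2]
    generalize (if i = j then (1:ℝ) else 0) = d
    simp [Fin.sum_univ_three]
    ring
  simp only [hq, hτd]
  have hI : (∫ p, F ((t, x), p) / nvS Φ ((t, x), p)) =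
      ∫ p : E3, f t x p / Real.sqrt (Real.exp (2 * φ t x) + ‖p‖ ^ 2) := rfl
  rw [hI] at hkin
  have hΦtx : Φ (t, x) = φ t x := rfl
  rw [hΦtx] at hkin
  have hs1 : ∀ v, B v (1, 0) = B (1, 0) v := fun v => hsymm v _
  have hfin : ∀ j, B (0, EuclideanSpace.single j 1) (0, EuclideanSpace.single i 1)
      = B (0, EuclideanSpace.single i 1) (0, EuclideanSpace.single j 1) := fun j => hsymm _ _
  simp only [Finset.sum_add_distrib, ite_mul, one_mul, zero_mul, Finset.sum_ite_eq,
    Finset.mem_univ, if_true, ← Finset.mul_sum, hfin,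
    hs1 (0, EuclideanSpace.single i 1)]
  linear_combination hkin - fderiv ℝ Φ (t, x) (0, EuclideanSpace.single i 1) * hW
end
end

section
/- Polytropic form of minimizers: let 0 < k < 2, J > 0, M > 0 with I^k_{M,J} < M, and let (f₀,φ₀) be a minimizer of the energy functional over the admissible pairs. Define the particle energy E(x,p) = √(e^{2φ₀(x)} + |p|²) and the constants E₀ = (1/M)(I^k_{M,J} − ((2−k)/6)∫_{ℝ³}|∇φ₀|² dx) and c = ((k+1)/(2−k))·(I^k_{M,J} − E₀M)/J^{1+1/k}. Then c > 0, E₀ lies in the open interval ( ((k+4)/6)·(I^k_{M,J}/M), I^k_{M,J}/M ), and f₀ is an isotropic polytrope: f₀(x,p) = ( (E₀ − E(x,p))/c )₊^k for almost every (x,p) ∈ ℝ³×ℝ³, where (·)₊ denotes the positive part. -/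
open MeasureTheory Real Filter Topology
open scoped ENNReal

noncomputable section

/-- `φ` belongs to (a C¹ surrogate of) the space `D¹(ℝ³)`: it is continuously
differentiable, its gradient is square integrable and it vanishes at infinity in
the sense that `{|φ| > a}` has finite measure for every `a > 0`. -/
def IsPotential (φ : E3 → ℝ) : Prop :=
  ContDiff ℝ 1 φ ∧ (∫⁻ x : E3, ENNReal.ofReal (‖gradient φ x‖ ^ 2)) < ⊤ ∧
    ∀ a : ℝ, 0 < a → volume {x : E3 | a < |φ x|} < ⊤

/-- `f ∈ Γ^k_{M,J}`: `f` is measurable, a.e. nonnegative, with `‖f‖_{L¹} = M` and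
`‖f‖_{L^{1+1/k}} ≤ J` (in particular `f ∈ L¹ ∩ L^{1+1/k}`). -/
def InGamma (k M J : ℝ) (f : E3 → E3 → ℝ) : Prop :=
  Measurable (Function.uncurry f) ∧
  (∀ᵐ z : E3 × E3, 0 ≤ f z.1 z.2) ∧
  (∫⁻ z : E3 × E3, ENNReal.ofReal (f z.1 z.2)) = ENNReal.ofReal M ∧
  eLpNorm (Function.uncurry f) (ENNReal.ofReal (1 + 1/k)) volume ≤ ENNReal.ofReal J

/-- Kinetic energy `E_kin(f,φ) = ∫∫ √(e^{2φ(x)}+|p|²) f(x,p) dp dx` (value in `[0,∞]`). -/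
def kinE (f : E3 → E3 → ℝ) (φ : E3 → ℝ) : ℝ≥0∞ :=
  ∫⁻ z : E3 × E3, ENNReal.ofReal (Real.sqrt (Real.exp (2 * φ z.1) + ‖z.2‖ ^ 2) * f z.1 z.2)

/-- Energy functional `𝓔(f,φ) = E_kin(f,φ) + (1/2)∫ |∇φ|²` (value in `[0,∞]`). -/
def energy (f : E3 → E3 → ℝ) (φ : E3 → ℝ) : ℝ≥0∞ :=
  kinE f φ + (∫⁻ x : E3, ENNReal.ofReal (‖gradient φ x‖ ^ 2)) / 2

/-- `(f,φ)` is admissible: `f ∈ Γ^k_{M,J}`, `φ` is a potential and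
`∫∫ √(1+|p|²) f dp dx < ∞`. -/
def Admissible (k M J : ℝ) (f : E3 → E3 → ℝ) (φ : E3 → ℝ) : Prop :=
  InGamma k M J f ∧ IsPotential φ ∧
  (∫⁻ z : E3 × E3, ENNReal.ofReal (Real.sqrt (1 + ‖z.2‖ ^ 2) * f z.1 z.2)) < ⊤

/-- The energy infimum `I^k_{M,J} = inf {𝓔(f,φ) : (f,φ) admissible}`. -/
def energyInf (k M J : ℝ) : ℝ≥0∞ :=
  sInf { e : ℝ≥0∞ | ∃ f φ, Admissible k M J f φ ∧ e = energy f φ }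


lemma vol_map_scale (l m : ℝ) (hl : 0 < l) (hm : 0 < m) :
    Measure.map (fun z : E3 × E3 => (l • z.1, m • z.2)) volume
      = ENNReal.ofReal ((l^3)⁻¹ * (m^3)⁻¹) • (volume : Measure (E3 × E3)) := by
  have h1 : Measure.map (fun x : E3 => l • x) volume = ENNReal.ofReal ((l^3)⁻¹) • volume := by
    have := Measure.map_addHaar_smul (volume : Measure E3) hl.ne'
    rw [this]; congr 2; rw [abs_of_pos (by positivity)]; simp
  have h2 : Measure.map (fun x : E3 => m • x) volume = ENNReal.ofReal ((m^3)⁻¹) • volume := by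
    have := Measure.map_addHaar_smul (volume : Measure E3) hm.ne'
    rw [this]; congr 2; rw [abs_of_pos (by positivity)]; simp
  have h3 := Measure.map_prod_map (volume : Measure E3) (volume : Measure E3)
    (f := fun x : E3 => l • x) (g := fun x : E3 => m • x) (by fun_prop) (by fun_prop)
  have h4 : (fun z : E3 × E3 => (l • z.1, m • z.2))
    = Prod.map (fun x : E3 => l • x) (fun x : E3 => m • x) := rfl
  rw [h4, Measure.volume_eq_prod, ← h3, h1, h2, Measure.prod_smul_left, Measure.prod_smul_right, smul_smul,
    ENNReal.ofReal_mul (by positivity)]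

lemma lint_scale (l m : ℝ) (hl : 0 < l) (hm : 0 < m) (F : E3 × E3 → ℝ≥0∞) (hF : Measurable F) :
    ∫⁻ z : E3 × E3, F (l • z.1, m • z.2)
      = ENNReal.ofReal ((l^3)⁻¹ * (m^3)⁻¹) * ∫⁻ z, F z := by
  have := lintegral_map (μ := (volume : Measure (E3 × E3))) hF
    (g := fun z : E3 × E3 => (l • z.1, m • z.2)) (by fun_prop)
  rw [← this, vol_map_scale l m hl hm, lintegral_smul_measure, smul_eq_mul]

lemma lint_scale1 (l : ℝ) (hl : 0 < l) (F : E3 → ℝ≥0∞) (hF : Measurable F) :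
    ∫⁻ z : E3, F (l • z) = ENNReal.ofReal ((l^3)⁻¹) * ∫⁻ z, F z := by
  have h1 : Measure.map (fun x : E3 => l • x) volume = ENNReal.ofReal ((l^3)⁻¹) • volume := by
    have := Measure.map_addHaar_smul (volume : Measure E3) hl.ne'
    rw [this]; congr 2; rw [abs_of_pos (by positivity)]; simp
  have := lintegral_map (μ := (volume : Measure E3)) hF
    (g := fun z : E3 => l • z) (by fun_prop)
  rw [← this, h1, lintegral_smul_measure, smul_eq_mul]

lemma gradient_scale (φ : E3 → ℝ) (hφ : Differentiable ℝ φ) (l : ℝ) (x : E3) :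
    gradient (fun y => φ (l • y)) x = l • gradient φ (l • x) := by
  have h : HasFDerivAt (fun y : E3 => φ (l • y)) (l • fderiv ℝ φ (l • x)) x := by
    have h0 : HasFDerivAt (fun y : E3 => l • y) (l • ContinuousLinearMap.id ℝ E3) x :=
      (hasFDerivAt_id x).const_smul l
    have := (hφ (l • x)).hasFDerivAt.comp x h0
    have e : (fderiv ℝ φ (l • x)).comp (l • ContinuousLinearMap.id ℝ E3) = l • fderiv ℝ φ (l • x) := by
      ext v; simp
    rw [e] at this
    exact this
  unfold gradient
  rw [h.fderiv]; simp

lemma continuous_gradient (φ : E3 → ℝ) (hφ : ContDiff ℝ 1 φ) : Continuous (gradient φ) := by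
  unfold gradient
  exact (LinearIsometryEquiv.continuous _).comp (hφ.continuous_fderiv (by norm_num))

lemma grad_energy_scale (φ : E3 → ℝ) (hφ : ContDiff ℝ 1 φ) (l : ℝ) (hl : 0 < l) :
    ∫⁻ x : E3, ENNReal.ofReal (‖gradient (fun y => φ (l • y)) x‖ ^ 2)
     = ENNReal.ofReal l⁻¹ * ∫⁻ x : E3, ENNReal.ofReal (‖gradient φ x‖ ^ 2) := by
  have hd : Differentiable ℝ φ := hφ.differentiable (by norm_num)
  have hc := continuous_gradient φ hφ
  have hm : Measurable fun x => ENNReal.ofReal (‖gradient φ x‖ ^ 2) := by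
    exact (hc.norm.pow 2).measurable.ennreal_ofReal
  have : ∀ x, ENNReal.ofReal (‖gradient (fun y => φ (l • y)) x‖ ^ 2)
     = ENNReal.ofReal (l^2) * ENNReal.ofReal (‖gradient φ (l • x)‖ ^ 2) := by
    intro x
    rw [gradient_scale φ hd, norm_smul, mul_pow, ENNReal.ofReal_mul (by positivity)]
    simp
  simp_rw [this]
  rw [lintegral_const_mul' _ _ ENNReal.ofReal_ne_top,
    lint_scale1 l hl _ hm, ← mul_assoc, ← ENNReal.ofReal_mul (by positivity)]
  congr 2; field_simp

lemma potential_scale (φ : E3 → ℝ) (hφ : IsPotential φ) (l : ℝ) (hl : 0 < l) :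
    IsPotential (fun y => φ (l • y)) := by
  obtain ⟨h1, h2, h3⟩ := hφ
  refine ⟨h1.comp (contDiff_const_smul l), ?_, ?_⟩
  · rw [grad_energy_scale φ h1 l hl]
    exact ENNReal.mul_lt_top ENNReal.ofReal_lt_top h2
  · intro a ha
    have hs : {x : E3 | a < |φ (l • x)|} = (fun x => l • x) ⁻¹' {x : E3 | a < |φ x|} := rfl
    rw [hs, Measure.addHaar_preimage_smul _ hl.ne']
    exact ENNReal.mul_lt_top ENNReal.ofReal_lt_top (h3 a ha)

lemma eLpNorm_le_iff' (k J : ℝ) (hk : 0 < k) (hJ : 0 < J) (f : E3 × E3 → ℝ)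
    (h0 : ∀ᵐ z, 0 ≤ f z) :
    eLpNorm f (ENNReal.ofReal (1 + 1/k)) volume ≤ ENNReal.ofReal J ↔
      ∫⁻ z, ENNReal.ofReal (f z ^ (1 + 1/k)) ≤ ENNReal.ofReal (J ^ (1+1/k)) := by
  have hq : 0 < 1 + 1/k := by positivity
  rw [eLpNorm_eq_lintegral_rpow_enorm_toReal (by simpa using hq) (by simp),
    ENNReal.toReal_ofReal hq.le, one_div (1+1/k), ENNReal.rpow_inv_le_iff hq,
    ENNReal.ofReal_rpow_of_pos hJ]
  have : ∫⁻ z, ENNReal.ofReal (f z ^ (1 + 1/k)) = ∫⁻ z, ‖f z‖ₑ ^ (1 + 1/k) := by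
    apply lintegral_congr_ae
    filter_upwards [h0] with z hz
    rw [Real.enorm_eq_ofReal hz, ENNReal.ofReal_rpow_of_nonneg hz hq.le]
  rw [this]

lemma scaled_bound (k M J : ℝ) (hk : 0 < k) (hJ : 0 < J) (g : E3 → E3 → ℝ) (φ : E3 → ℝ)
    (hgm : Measurable (Function.uncurry g)) (hg0 : ∀ᵐ z : E3 × E3, 0 ≤ g z.1 z.2)
    (hφ : IsPotential φ)
    (hkin : ∫⁻ z : E3 × E3, ENNReal.ofReal (Real.sqrt (1 + ‖z.2‖ ^ 2) * g z.1 z.2) < ⊤)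
    (a l m : ℝ) (ha : 0 < a) (hl : 0 < l) (hm : 0 < m)
    (h1 : ENNReal.ofReal (a * ((l^3)⁻¹ * (m^3)⁻¹)) * ∫⁻ z : E3 × E3, ENNReal.ofReal (g z.1 z.2)
      = ENNReal.ofReal M)
    (h2 : ENNReal.ofReal (a ^ (1 + 1/k) * ((l^3)⁻¹ * (m^3)⁻¹))
      * ∫⁻ z : E3 × E3, ENNReal.ofReal (g z.1 z.2 ^ (1 + 1/k)) ≤ ENNReal.ofReal (J ^ (1+1/k))) :
    energyInf k M J ≤ ENNReal.ofReal (a * ((l^3)⁻¹ * (m^3)⁻¹)) *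
      (∫⁻ z : E3 × E3, ENNReal.ofReal
        (Real.sqrt (Real.exp (2 * φ z.1) + (m⁻¹ * ‖z.2‖) ^ 2) * g z.1 z.2))
      + ENNReal.ofReal l⁻¹ * (∫⁻ x : E3, ENNReal.ofReal (‖gradient φ x‖ ^ 2)) / 2 := by
  have hq : 0 < 1 + 1/k := by positivity
  have hgm' : Measurable fun z : E3 × E3 => g z.1 z.2 := hgm
  have hφm : Measurable φ := hφ.1.continuous.measurable
  have key : ∀ (W : E3 × E3 → ℝ) (b : ℝ), 0 ≤ b → Measurable W →
      ∫⁻ z : E3 × E3, ENNReal.ofReal (b * W (l • z.1, m • z.2))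
       = ENNReal.ofReal (b * ((l^3)⁻¹ * (m^3)⁻¹)) * ∫⁻ z, ENNReal.ofReal (W z) := by
    intro W b hb hW
    have hWm : Measurable fun z => ENNReal.ofReal (W z) := hW.ennreal_ofReal
    simp_rw [ENNReal.ofReal_mul hb]
    rw [lintegral_const_mul' _ _ ENNReal.ofReal_ne_top, lint_scale l m hl hm _ hWm, mul_assoc]
  have hqmp : ∀ᵐ z : E3 × E3, 0 ≤ g (l • z.1) (m • z.2) := by
    have : ∀ᵐ z ∂(Measure.map (fun z : E3 × E3 => (l • z.1, m • z.2)) volume),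
        0 ≤ g z.1 z.2 := by
      rw [vol_map_scale l m hl hm]
      exact Measure.ae_smul_measure hg0 _
    exact ae_of_ae_map (f := fun z : E3 × E3 => (l • z.1, m • z.2)) (by fun_prop) this
  let f : E3 → E3 → ℝ := fun x p => a * g (l • x) (m • p)
  have hf0 : ∀ᵐ z : E3 × E3, 0 ≤ f z.1 z.2 := by
    filter_upwards [hqmp] with z hz
    exact mul_nonneg ha.le hz
  have hA : Admissible k M J f (fun y => φ (l • y)) := by
    refine ⟨⟨?_, hf0, ?_, ?_⟩, potential_scale φ hφ l hl, ?_⟩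
    · exact (hgm'.comp (by fun_prop : Measurable
      (fun z : E3 × E3 => (l • z.1, m • z.2)))).const_mul a
    · rw [← h1]; exact key (fun z => g z.1 z.2) a ha.le hgm'
    · rw [eLpNorm_le_iff' k J hk hJ (Function.uncurry f) hf0]
      refine le_trans (le_of_eq ?_) h2
      rw [← key (fun z => g z.1 z.2 ^ (1+1/k)) _ (by positivity) (hgm'.pow_const _)]
      apply lintegral_congr_ae
      filter_upwards [hqmp] with z hz
      simp only [Function.uncurry, f]
      rw [Real.mul_rpow ha.le hz]
    · have hb := key (fun z => Real.sqrt (1 + ‖z.2‖ ^ 2) * g z.1 z.2) (a * (1 + m⁻¹)) (by positivity)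
        (by fun_prop)
      refine lt_of_le_of_lt ?_ (lt_of_eq_of_lt hb (ENNReal.mul_lt_top ENNReal.ofReal_lt_top hkin))
      apply lintegral_mono_ae
      filter_upwards [hqmp] with z hz
      apply ENNReal.ofReal_le_ofReal
      simp only [f]
      have : Real.sqrt (1 + ‖z.2‖^2) ≤ (1 + m⁻¹) * Real.sqrt (1 + ‖m • z.2‖^2) := by
        rw [Real.sqrt_le_left (by positivity), mul_pow, Real.sq_sqrt (by positivity), norm_smul,
          Real.norm_of_nonneg hm.le]
        have e : (m⁻¹)^2 * (m * ‖z.2‖)^2 = ‖z.2‖^2 := by field_simp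
        have : 0 < m⁻¹ := by positivity
        nlinarith [sq_nonneg (m * ‖z.2‖), mul_nonneg this.le (sq_nonneg (m * ‖z.2‖)), sq_nonneg m⁻¹]
      calc _ ≤ ((1 + m⁻¹) * Real.sqrt (1 + ‖m • z.2‖^2)) * (a * g (l • z.1) (m • z.2)) :=
            mul_le_mul_of_nonneg_right this (mul_nonneg ha.le hz)
        _ = _ := by ring
  have hle : energyInf k M J ≤ energy f (fun y => φ (l • y)) := sInf_le ⟨_, _, hA, rfl⟩
  refine hle.trans (le_of_eq ?_)
  unfold energy kinE
  rw [grad_energy_scale φ hφ.1 l hl]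
  congr 1
  rw [← key (fun z => Real.sqrt (Real.exp (2 * φ z.1) + (m⁻¹ * ‖z.2‖) ^ 2) * g z.1 z.2) a ha.le
    (by fun_prop)]
  congr 1; ext z
  simp only [f, norm_smul, Real.norm_of_nonneg hm.le]
  congr 1
  rw [inv_mul_cancel_left₀ hm.ne']
  ring

lemma psi_min (k c h y : ℝ) (hk : 0 < k) (hc : 0 < c) (hy : 0 ≤ y)
    (hne : y ≠ (max (-h / c) 0) ^ k) :
    h * (max (-h / c) 0) ^ k + c / (1 + 1/k) * ((max (-h / c) 0) ^ k) ^ (1 + 1/k)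
      < h * y + c / (1 + 1/k) * y ^ (1 + 1/k) := by
  have hq : 1 < 1 + 1/k := by
    have : 0 < 1/k := by positivity
    linarith
  rcases le_or_gt 0 h with hh | hh
  · have : max (-h / c) 0 = 0 := max_eq_right (by
      rw [neg_div]; have := div_nonneg hh hc.le; linarith)
    rw [this, Real.zero_rpow hk.ne'] at hne ⊢
    rw [Real.zero_rpow (by linarith)]
    have hy' : 0 < y := lt_of_le_of_ne hy (Ne.symm hne)
    have : 0 < c / (1 + 1/k) * y ^ (1 + 1/k) := by positivity
    have := mul_nonneg hh hy
    linarith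
  · have hpos : 0 < -h / c := div_pos (by linarith) hc
    rw [max_eq_left hpos.le] at hne ⊢
    set s := (-h / c) ^ k with hs
    have hs0 : 0 < s := Real.rpow_pos_of_pos hpos _
    have hs1 : s ^ (1/k) = -h / c := by
      rw [hs, ← Real.rpow_mul hpos.le, mul_one_div_cancel hk.ne', Real.rpow_one]
    have hh' : h = - c * s ^ (1/k) := by rw [hs1, neg_mul, mul_div_cancel₀ _ hc.ne', neg_neg]
    have hsq : s ^ (1 + 1/k) = s * s ^ (1/k) := by
      rw [Real.rpow_add hs0, Real.rpow_one]
    have hb := one_add_mul_self_lt_rpow_one_add (s := y / s - 1) (p := 1 + 1/k)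
      (by have := div_nonneg hy hs0.le; linarith)
      (by intro h0; apply hne; field_simp at h0; linarith) hq
    have e : 1 + (y / s - 1) = y / s := by ring
    rw [e, Real.div_rpow hy hs0.le, lt_div_iff₀ (by positivity)] at hb
    have h3 := mul_lt_mul_of_pos_left hb (show 0 < c / (1+1/k) by positivity)
    rw [hsq] at h3 ⊢
    generalize s ^ (1/k) = r at *
    subst hh'
    have e2 : c / (1 + 1/k) * ((1 + (1+1/k) * (y / s - 1)) * (s * r))
      = c / (1 + 1/k) * (s*r) + c * (y - s) * r := by field_simp
    rw [e2] at h3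
    linarith

lemma grad_integrable (φ : E3 → ℝ) (hφ : IsPotential φ) :
    Integrable (fun x : E3 => ‖gradient φ x‖ ^ 2) := by
  have hc := continuous_gradient φ hφ.1
  refine ⟨(hc.norm.pow 2).aestronglyMeasurable, ?_⟩
  rw [hasFiniteIntegral_iff_ofReal (Eventually.of_forall fun x => by positivity)]
  exact hφ.2.1

lemma scaled_real (k M J : ℝ) (hk : 0 < k) (hJ : 0 < J) (g : E3 → E3 → ℝ) (φ : E3 → ℝ)
    (hgm : Measurable (Function.uncurry g)) (hg0 : ∀ᵐ z : E3 × E3, 0 ≤ g z.1 z.2)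
    (hφ : IsPotential φ)
    (hkin : ∫⁻ z : E3 × E3, ENNReal.ofReal (Real.sqrt (1 + ‖z.2‖ ^ 2) * g z.1 z.2) < ⊤)
    (a l m : ℝ) (ha : 0 < a) (hl : 0 < l) (hm : 0 < m)
    (hg : Integrable (fun z : E3 × E3 => g z.1 z.2))
    (hN : Integrable (fun z : E3 × E3 => g z.1 z.2 ^ (1 + 1/k)))
    (hK : Integrable (fun z : E3 × E3 =>
      Real.sqrt (Real.exp (2 * φ z.1) + (m⁻¹ * ‖z.2‖) ^ 2) * g z.1 z.2))
    (h1 : a * ((l^3)⁻¹ * (m^3)⁻¹) * ∫ z : E3 × E3, g z.1 z.2 = M)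
    (h2 : a ^ (1 + 1/k) * ((l^3)⁻¹ * (m^3)⁻¹)
      * ∫ z : E3 × E3, g z.1 z.2 ^ (1 + 1/k) ≤ J ^ (1+1/k)) :
    (energyInf k M J).toReal ≤ a * ((l^3)⁻¹ * (m^3)⁻¹) *
      (∫ z : E3 × E3, Real.sqrt (Real.exp (2 * φ z.1) + (m⁻¹ * ‖z.2‖) ^ 2) * g z.1 z.2)
      + l⁻¹ * (∫ x : E3, ‖gradient φ x‖ ^ 2) / 2 := by
  have hD : 0 < (l^3)⁻¹ * (m^3)⁻¹ := by positivity
  have hN0 : ∀ᵐ z : E3 × E3, 0 ≤ g z.1 z.2 ^ (1 + 1/k) := by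
    filter_upwards [hg0] with z hz using Real.rpow_nonneg hz _
  have hK0 : ∀ᵐ z : E3 × E3,
      0 ≤ Real.sqrt (Real.exp (2 * φ z.1) + (m⁻¹ * ‖z.2‖) ^ 2) * g z.1 z.2 := by
    filter_upwards [hg0] with z hz using mul_nonneg (Real.sqrt_nonneg _) hz
  have hG := grad_integrable φ hφ
  have hG0 : ∀ᵐ x : E3, 0 ≤ ‖gradient φ x‖ ^ 2 := Eventually.of_forall fun x => by positivity
  have := scaled_bound k M J hk hJ g φ hgm hg0 hφ hkin a l m ha hl hm
    (by rw [← ofReal_integral_eq_lintegral_ofReal hg hg0, ← ENNReal.ofReal_mul (by positivity), h1])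
    (by rw [← ofReal_integral_eq_lintegral_ofReal hN hN0, ← ENNReal.ofReal_mul (by positivity)]
        exact ENNReal.ofReal_le_ofReal h2)
  rw [← ofReal_integral_eq_lintegral_ofReal hK hK0, ← ENNReal.ofReal_mul (by positivity),
    ← ofReal_integral_eq_lintegral_ofReal hG hG0, ← ENNReal.ofReal_mul (by positivity)] at this
  have i1 := integral_nonneg_of_ae hK0
  have i2 := integral_nonneg_of_ae hG0
  have e2 : ∀ A : ℝ, ENNReal.ofReal A / 2 = ENNReal.ofReal (A / 2) := by
    intro A; rw [ENNReal.ofReal_div_of_pos (by norm_num)]; simp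
  rw [e2, ← ENNReal.ofReal_add (by positivity) (by positivity)] at this
  exact ENNReal.toReal_le_of_le_ofReal (by positivity) this

lemma grad_pos (φ : E3 → ℝ) (hφ : IsPotential φ) (f : E3 → E3 → ℝ) (M : ℝ)
    (h0 : ∀ᵐ z : E3 × E3, 0 ≤ f z.1 z.2)
    (hm : (∫⁻ z : E3 × E3, ENNReal.ofReal (f z.1 z.2)) = ENNReal.ofReal M)
    (hlt : energy f φ < ENNReal.ofReal M) : 0 < ∫ x : E3, ‖gradient φ x‖ ^ 2 := by
  have hG := grad_integrable φ hφ
  have hnn : 0 ≤ ∫ x : E3, ‖gradient φ x‖ ^ 2 := integral_nonneg fun x => by positivity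
  rcases hnn.lt_or_eq with h | h
  · exact h
  exfalso
  have hc := continuous_gradient φ hφ.1
  have hae := (integral_eq_zero_iff_of_nonneg (fun x => by positivity) hG).1 h.symm
  have hz : (fun x : E3 => ‖gradient φ x‖ ^ 2) = 0 :=
    Continuous.ae_eq_iff_eq volume (hc.norm.pow 2) continuous_zero |>.1 hae
  have hd : Differentiable ℝ φ := hφ.1.differentiable (by norm_num)
  have hfd : ∀ x, fderiv ℝ φ x = 0 := by
    intro x
    have : gradient φ x = 0 := by simpa using congrFun hz x
    unfold gradient at this
    simpa using this
  have hconst : ∀ x, φ x = φ 0 := fun x => is_const_of_fderiv_eq_zero hd hfd x 0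
  have hφ0 : φ 0 = 0 := by
    by_contra hne
    have hp : 0 < |φ 0| := abs_pos.2 hne
    have := hφ.2.2 (|φ 0| / 2) (by positivity)
    have hs : {x : E3 | |φ 0| / 2 < |φ x|} = Set.univ := by
      ext x; simp only [Set.mem_ofPred_eq, Set.mem_univ, iff_true, hconst x]; linarith
    rw [hs] at this
    simp at this
  refine absurd hlt (not_lt.2 ?_)
  refine le_trans ?_ (le_self_add : kinE f φ ≤ energy f φ)
  rw [← hm]
  apply lintegral_mono_ae
  filter_upwards [h0] with z hz
  apply ENNReal.ofReal_le_ofReal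
  rw [hconst z.1, hφ0]
  have : 1 ≤ Real.sqrt (Real.exp (2 * 0) + ‖z.2‖ ^ 2) := by
    rw [Real.one_le_sqrt]; simp
  nlinarith

lemma lambda_choice (k u v : ℝ) (hk : 0 < k) (hk2 : k < 2) (hu : 0 < u) (hv : 0 < v) :
    ∃ l : ℝ, 0 < l ∧ (l ^ 3 / u) ^ (1 + 1/k) * (l^3)⁻¹ * v = 1 ∧
      u * l⁻¹ ≤ (k/3) * v + (2-k)/3 * u + 1/3 := by
  refine ⟨(u ^ (1 + 1/k) / v) ^ (k/3), by positivity, ?_, ?_⟩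
  · have e : ((u ^ (1 + 1/k) / v) ^ (k/3)) ^ 3 = (u ^ (1 + 1/k) / v) ^ k := by
      rw [← Real.rpow_natCast, ← Real.rpow_mul (by positivity)]; congr 1; push_cast; ring
    rw [e]
    set w := u ^ (1 + 1/k) / v with hw
    have hw0 : 0 < w := by positivity
    have hwk : 0 < w ^ k := by positivity
    rw [Real.div_rpow hwk.le hu.le, Real.rpow_add hwk, Real.rpow_one, ← Real.rpow_mul hw0.le,
      mul_one_div_cancel hk.ne', Real.rpow_one]
    rw [show u ^ (1+1/k) = w * v by rw [hw]; field_simp]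
    field_simp
  · have hg := Real.geom_mean_le_arith_mean3_weighted (w₁ := k/3) (w₂ := (2-k)/3) (w₃ := 1/3)
      (p₁ := v) (p₂ := u) (p₃ := 1) (by linarith) (by linarith) (by norm_num) hv.le hu.le (by norm_num)
      (by ring)
    rw [Real.one_rpow] at hg
    refine le_trans (le_of_eq ?_) (hg.trans (by linarith))
    rw [Real.div_rpow (by positivity) hv.le, ← Real.rpow_mul hu.le, inv_div,
      show (1 + 1/k) * (k/3) = (k+1)/3 by field_simp,
      show (2-k)/3 = 1 - (k+1)/3 by ring, Real.rpow_sub hu, Real.rpow_one]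
    ring

lemma virial_ineq (k M J : ℝ) (hk : 0 < k) (hM : 0 < M) (hJ : 0 < J)
    (f : E3 → E3 → ℝ) (φ : E3 → ℝ)
    (hgm : Measurable (Function.uncurry f)) (hf0 : ∀ᵐ z : E3 × E3, 0 ≤ f z.1 z.2)
    (hφ : IsPotential φ)
    (hkin : ∫⁻ z : E3 × E3, ENNReal.ofReal (Real.sqrt (1 + ‖z.2‖ ^ 2) * f z.1 z.2) < ⊤)
    (hg : Integrable (fun z : E3 × E3 => f z.1 z.2))
    (hN : Integrable (fun z : E3 × E3 => f z.1 z.2 ^ (1 + 1/k)))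
    (hK : Integrable (fun z : E3 × E3 =>
      Real.sqrt (Real.exp (2 * φ z.1) + ‖z.2‖ ^ 2) * f z.1 z.2))
    (h1 : ∫ z : E3 × E3, f z.1 z.2 = M)
    (h2 : ∫ z : E3 × E3, f z.1 z.2 ^ (1 + 1/k) ≤ J ^ (1+1/k))
    (hI : (energyInf k M J).toReal =
      (∫ z : E3 × E3, Real.sqrt (Real.exp (2 * φ z.1) + ‖z.2‖ ^ 2) * f z.1 z.2)
        + (∫ x : E3, ‖gradient φ x‖ ^ 2) / 2) :
    (∫ x : E3, ‖gradient φ x‖ ^ 2) / 2 <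
      ∫ z : E3 × E3, Real.sqrt (Real.exp (2 * φ z.1) + ‖z.2‖ ^ 2) * f z.1 z.2 := by
  have hfm : Measurable fun z : E3 × E3 => f z.1 z.2 := hgm
  have hφm : Measurable φ := hφ.1.continuous.measurable
  set E : E3 × E3 → ℝ := fun z => Real.sqrt (Real.exp (2 * φ z.1) + ‖z.2‖ ^ 2) with hE
  have hEm : Measurable E := by fun_prop
  have hE0 : ∀ z, 0 < E z := fun z => Real.sqrt_pos.2 (by positivity)
  have hEsq : ∀ z, E z ^ 2 = Real.exp (2 * φ z.1) + ‖z.2‖ ^ 2 := fun z =>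
    Real.sq_sqrt (by positivity)
  have hPlt : ∀ z, ‖z.2‖ ^ 2 / E z < E z := fun z => by
    rw [div_lt_iff₀ (hE0 z), ← sq, hEsq]
    have := Real.exp_pos (2 * φ z.1); linarith
  have hP : Integrable (fun z : E3 × E3 => ‖z.2‖ ^ 2 / E z * f z.1 z.2) := by
    refine hK.mono' (by fun_prop) ?_
    filter_upwards [hf0] with z hz
    have : 0 ≤ ‖z.2‖ ^ 2 / E z := div_nonneg (by positivity) (hE0 z).le
    rw [Real.norm_of_nonneg (mul_nonneg this hz)]
    exact mul_le_mul_of_nonneg_right (hPlt z).le hz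
  set G := ∫ x : E3, ‖gradient φ x‖ ^ 2 with hG
  set K := ∫ z : E3 × E3, Real.sqrt (Real.exp (2 * φ z.1) + ‖z.2‖ ^ 2) * f z.1 z.2 with hKdef
  set P := ∫ z : E3 × E3, ‖z.2‖ ^ 2 / E z * f z.1 z.2 with hPdef
  have hPK : P < K := by
    have hint : Integrable (fun z : E3 × E3 => (E z - ‖z.2‖ ^ 2 / E z) * f z.1 z.2) := by
      have := hK.sub hP
      refine this.congr (Eventually.of_forall fun z => ?_)
      simp only [Pi.sub_apply, hE]; ring
    have heq : ∫ z : E3 × E3, (E z - ‖z.2‖ ^ 2 / E z) * f z.1 z.2 = K - P := by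
      rw [hKdef, hPdef, ← integral_sub hK hP]
      congr 1; ext z; simp only [hE]; ring
    have hnn : 0 ≤ᵐ[volume] (fun z : E3 × E3 => (E z - ‖z.2‖ ^ 2 / E z) * f z.1 z.2) := by
      filter_upwards [hf0] with z hz
      exact mul_nonneg (sub_nonneg.2 (hPlt z).le) hz
    have h0 := integral_nonneg_of_ae hnn
    rcases h0.lt_or_eq with h | h
    · linarith
    · exfalso
      have hz := (integral_eq_zero_iff_of_nonneg_ae hnn hint).1 h.symm
      have : ∫ z : E3 × E3, f z.1 z.2 = 0 := by
        rw [← integral_zero (E3 × E3) ℝ]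
        apply integral_congr_ae
        filter_upwards [hz] with z hz
        exact (mul_eq_zero.1 hz).resolve_left (sub_pos.2 (hPlt z)).ne'
      linarith
  have hlam : ∀ l : ℝ, 1 < l → G / 2 ≤ l * (l + 1) / 2 * P := by
    intro l hl
    have hl0 : 0 < l := by linarith
    have hKl : Integrable (fun z : E3 × E3 =>
        Real.sqrt (Real.exp (2 * φ z.1) + ((l⁻¹)⁻¹ * ‖z.2‖) ^ 2) * f z.1 z.2) := by
      refine (hK.const_mul l).mono' (by fun_prop) ?_
      filter_upwards [hf0] with z hz
      rw [Real.norm_of_nonneg (mul_nonneg (Real.sqrt_nonneg _) hz), ← mul_assoc]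
      apply mul_le_mul_of_nonneg_right _ hz
      rw [Real.sqrt_le_left (by positivity), mul_pow, mul_pow, Real.sq_sqrt (by positivity), inv_inv]
      have := Real.exp_pos (2 * φ z.1)
      nlinarith [mul_pos this (show 0 < l^2 - 1 by nlinarith)]
    have hD : ((l^3)⁻¹ * ((l⁻¹)^3)⁻¹) = 1 := by field_simp
    have := scaled_real k M J hk hJ f φ hgm hf0 hφ hkin 1 l l⁻¹ one_pos hl0 (by positivity)
      hg hN hKl (by rw [hD]; simpa using h1) (by rw [hD]; simpa using h2)
    rw [hD, hI, one_mul, one_mul] at this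
    have hb : ∫ z : E3 × E3, Real.sqrt (Real.exp (2 * φ z.1) + ((l⁻¹)⁻¹ * ‖z.2‖) ^ 2) * f z.1 z.2
        ≤ K + (l^2 - 1)/2 * P := by
      rw [hKdef, hPdef, ← integral_const_mul, ← integral_add hK (hP.const_mul _)]
      apply integral_mono_ae hKl (hK.add (hP.const_mul _))
      filter_upwards [hf0] with z hz
      simp only [Pi.add_apply]
      have hs : Real.sqrt (Real.exp (2 * φ z.1) + ((l⁻¹)⁻¹ * ‖z.2‖) ^ 2)
          ≤ E z + (l^2 - 1)/2 * (‖z.2‖^2 / E z) := by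
        have hp : 0 ≤ (l^2 - 1)/2 * (‖z.2‖^2 / E z) :=
          mul_nonneg (by nlinarith) (div_nonneg (by positivity) (hE0 z).le)
        rw [Real.sqrt_le_left (add_nonneg (hE0 z).le hp), inv_inv, add_sq, hEsq]
        have e : 2 * E z * ((l^2 - 1)/2 * (‖z.2‖^2 / E z)) = (l^2-1) * ‖z.2‖^2 := by
          have := (hE0 z).ne'
          field_simp
        rw [e]
        nlinarith [sq_nonneg ((l^2 - 1)/2 * (‖z.2‖^2 / E z))]
      calc _ ≤ (E z + (l^2 - 1)/2 * (‖z.2‖^2 / E z)) * f z.1 z.2 :=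
            mul_le_mul_of_nonneg_right hs hz
        _ = _ := by simp only [hE]; ring
    have h3 : G / 2 - l⁻¹ * G / 2 ≤ (l^2 - 1)/2 * P := by linarith
    have h4 : (l - 1) * (G/2) ≤ (l - 1) * (l * (l + 1) / 2 * P) := by
      have := mul_le_mul_of_nonneg_left h3 hl0.le
      have e : l * (G / 2 - l⁻¹ * G / 2) = (l - 1) * (G/2) := by field_simp
      rw [e] at this
      linarith
    exact le_of_mul_le_mul_left h4 (by linarith)
  have hlim : G / 2 ≤ 1 * (1 + 1) / 2 * P := by
    have ht : Tendsto (fun l : ℝ => l * (l + 1) / 2 * P) (𝓝[>] 1) (𝓝 (1 * (1 + 1) / 2 * P)) := by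
      apply tendsto_nhdsWithin_of_tendsto_nhds
      exact (by fun_prop : Continuous fun l : ℝ => l * (l + 1) / 2 * P).tendsto 1
    refine ge_of_tendsto ht ?_
    filter_upwards [self_mem_nhdsWithin] with l hl using hlam l hl
  linarith

lemma integrable_bdd (S : Set (E3 × E3)) (hS : MeasurableSet S) (hv : volume S < ⊤)
    (F : E3 × E3 → ℝ) (hF : Measurable F) (C : ℝ) (hC : ∀ z ∈ S, |F z| ≤ C)
    (h0 : ∀ z, z ∉ S → F z = 0) : Integrable F := by
  have h1 : IntegrableOn F S := Measure.integrableOn_of_bounded hv.ne hF.aestronglyMeasurable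
    (M := C) ((ae_restrict_iff' hS).2 (Eventually.of_forall hC))
  rwa [integrableOn_iff_integrable_of_support_subset] at h1
  intro z hz
  by_contra h
  exact hz (h0 z h)

lemma integral_split (E g N : E3 × E3 → ℝ) (a b : ℝ) (h1 : Integrable (fun z => E z * g z))
    (h2 : Integrable g) (h3 : Integrable N) :
    ∫ z, ((E z - a) * g z + b * N z) = (∫ z, E z * g z) + b * (∫ z, N z) - a * ∫ z, g z := by
  have e : ∀ z, (E z - a) * g z + b * N z = (E z * g z - a * g z) + b * N z := fun z => by ring
  simp_rw [e]
  have hs : Integrable (fun z => E z * g z - a * g z) := h1.sub (h2.const_mul a)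
  rw [integral_add hs (h3.const_mul b), integral_sub h1 (h2.const_mul a),
    integral_const_mul, integral_const_mul]
  ring

set_option maxHeartbeats 2000000 in
/-- polytropic form of minimizers.  With
`E₀ = (1/M)(I − ((2−k)/6)∫|∇φ₀|²)` and `c = ((k+1)/(2−k))(I − E₀M)/J^{1+1/k}`,
a minimizer satisfies `c > 0`, `E₀ ∈ (((k+4)/6)(I/M), I/M)` and
`f₀(x,p) = ((E₀ − E(x,p))/c)₊^k` a.e., where `E(x,p) = √(e^{2φ₀(x)}+|p|²)`. -/
theorem minimizer_is_polytrope (k M J : ℝ)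
    (hk : 0 < k) (hk2 : k < 2) (hM : 0 < M) (hJ : 0 < J)
    (hlt : energyInf k M J < ENNReal.ofReal M)
    (f₀ : E3 → E3 → ℝ) (φ₀ : E3 → ℝ)
    (hadm : Admissible k M J f₀ φ₀)
    (hmin : energy f₀ φ₀ = energyInf k M J)
    (E₀ c : ℝ)
    (hE₀ : E₀ = (1 / M) * ((energyInf k M J).toReal
      - ((2 - k) / 6) * ∫ x : E3, ‖gradient φ₀ x‖ ^ 2))
    (hc : c = ((k + 1) / (2 - k)) * (((energyInf k M J).toReal - E₀ * M) / J ^ (1 + 1/k))) :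
    0 < c
    ∧ E₀ ∈ Set.Ioo (((k + 4) / 6) * ((energyInf k M J).toReal / M))
        ((energyInf k M J).toReal / M)
    ∧ ∀ᵐ z : E3 × E3, f₀ z.1 z.2
        = (max ((E₀ - Real.sqrt (Real.exp (2 * φ₀ z.1) + ‖z.2‖ ^ 2)) / c) 0) ^ k := by

  obtain ⟨⟨hfm, hf0, hfM, hfJ⟩, hφ, hkin⟩ := hadm
  have hfm' : Measurable fun z : E3 × E3 => f₀ z.1 z.2 := hfm
  have hφm : Measurable φ₀ := hφ.1.continuous.measurable
  have hq1 : 0 < 1 / k := by positivity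
  have hq : 0 < 1 + 1/k := by positivity
  have hen : energy f₀ φ₀ < ENNReal.ofReal M := by rw [hmin]; exact hlt
  have hGpos := grad_pos φ₀ hφ f₀ M hf0 hfM hen
  have hGi := grad_integrable φ₀ hφ
  set E : E3 × E3 → ℝ := fun z => Real.sqrt (Real.exp (2 * φ₀ z.1) + ‖z.2‖ ^ 2) with hE
  have hEm : Measurable E := by fun_prop
  have hEpos : ∀ z, 0 < E z := fun z => Real.sqrt_pos.2 (by positivity)
  -- integrability of f₀
  have hfi : Integrable (fun z : E3 × E3 => f₀ z.1 z.2) := by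
    refine ⟨hfm'.aestronglyMeasurable, ?_⟩
    rw [hasFiniteIntegral_iff_ofReal hf0, hfM]; exact ENNReal.ofReal_lt_top
  have hfint : ∫ z : E3 × E3, f₀ z.1 z.2 = M := by
    rw [integral_eq_lintegral_of_nonneg_ae hf0 hfm'.aestronglyMeasurable, hfM,
      ENNReal.toReal_ofReal hM.le]
  have hN0 : ∀ᵐ z : E3 × E3, 0 ≤ f₀ z.1 z.2 ^ (1 + 1/k) := by
    filter_upwards [hf0] with z hz using Real.rpow_nonneg hz _
  have hNl := (eLpNorm_le_iff' k J hk hJ (Function.uncurry f₀) hf0).1 hfJ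
  have hNi : Integrable (fun z : E3 × E3 => f₀ z.1 z.2 ^ (1 + 1/k)) := by
    refine ⟨(hfm'.pow_const _).aestronglyMeasurable, ?_⟩
    rw [hasFiniteIntegral_iff_ofReal hN0]
    exact lt_of_le_of_lt hNl ENNReal.ofReal_lt_top
  have hNint : ∫ z : E3 × E3, f₀ z.1 z.2 ^ (1 + 1/k) ≤ J ^ (1+1/k) := by
    rw [integral_eq_lintegral_of_nonneg_ae hN0 (hfm'.pow_const _).aestronglyMeasurable]
    exact ENNReal.toReal_le_of_le_ofReal (by positivity) hNl
  have hK0 : ∀ᵐ z : E3 × E3, 0 ≤ E z * f₀ z.1 z.2 := by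
    filter_upwards [hf0] with z hz using mul_nonneg (hEpos z).le hz
  have hKm : Measurable fun z : E3 × E3 => E z * f₀ z.1 z.2 := hEm.mul hfm'
  have hKi : Integrable (fun z : E3 × E3 => E z * f₀ z.1 z.2) := by
    refine ⟨hKm.aestronglyMeasurable, ?_⟩
    rw [hasFiniteIntegral_iff_ofReal hK0]
    exact lt_of_le_of_lt (le_self_add : kinE f₀ φ₀ ≤ energy f₀ φ₀)
      (hen.trans ENNReal.ofReal_lt_top)
  have hI : (energyInf k M J).toReal = (∫ z : E3 × E3, E z * f₀ z.1 z.2)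
      + (∫ x : E3, ‖gradient φ₀ x‖ ^ 2) / 2 := by
    have e2 : ∀ A : ℝ, ENNReal.ofReal A / 2 = ENNReal.ofReal (A / 2) := by
      intro A; rw [ENNReal.ofReal_div_of_pos (by norm_num)]; simp
    have hk1 : kinE f₀ φ₀ = ENNReal.ofReal (∫ z : E3 × E3, E z * f₀ z.1 z.2) :=
      (ofReal_integral_eq_lintegral_ofReal hKi hK0).symm
    have i1 := integral_nonneg_of_ae hK0
    rw [← hmin, energy, hk1, ← ofReal_integral_eq_lintegral_ofReal hGi
      (Eventually.of_forall fun x => by positivity), e2, ← ENNReal.ofReal_add i1 (by positivity),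
      ENNReal.toReal_ofReal (by positivity)]
  have hvir := virial_ineq k M J hk hM hJ f₀ φ₀ hfm hf0 hφ hkin hfi hNi hKi hfint hNint hI
  have hIM : (energyInf k M J).toReal < M := by
    have := (ENNReal.toReal_lt_toReal (ne_top_of_lt hlt) ENNReal.ofReal_ne_top).2 hlt
    rwa [ENNReal.toReal_ofReal hM.le] at this
  have hKdef : ∫ z : E3 × E3, Real.sqrt (Real.exp (2 * φ₀ z.1) + ‖z.2‖ ^ 2) * f₀ z.1 z.2
    = ∫ z : E3 × E3, E z * f₀ z.1 z.2 := rfl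
  rw [hKdef] at hvir
  set G := ∫ x : E3, ‖gradient φ₀ x‖ ^ 2 with hG
  set K := ∫ z : E3 × E3, E z * f₀ z.1 z.2 with hK
  have hE0M : E₀ * M = (energyInf k M J).toReal - (2 - k) / 6 * G := by
    rw [hE₀]; field_simp
  set I := (energyInf k M J).toReal with hIdef
  have hJq : 0 < J ^ (1 + 1/k) := by positivity
  have h2k : 0 < 2 - k := by linarith
  have hc' : c = (k + 1) / 6 * G / J ^ (1 + 1/k) := by
    rw [hc, hE0M]; field_simp; ring
  have hcpos : 0 < c := by rw [hc']; positivity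
  have hup : E₀ < I / M := by
    rw [lt_div_iff₀ hM, hE0M]
    have : 0 < (2 - k) / 6 * G := by positivity
    linarith
  have hlow : (k + 4) / 6 * (I / M) < E₀ := by
    have : (k + 4) / 6 * (I / M) = (k + 4) / 6 * I / M := by ring
    rw [this, div_lt_iff₀ hM, hE0M]
    nlinarith
  refine ⟨hcpos, ⟨hlow, hup⟩, ?_⟩
  have hE01 : E₀ < 1 := hup.trans (by rw [div_lt_one hM]; exact hIM)
  have hE00 : 0 < E₀ := by
    refine lt_of_le_of_lt ?_ hlow
    have : 0 ≤ I := ENNReal.toReal_nonneg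
    positivity
  -- the competitor
  let gs : E3 → E3 → ℝ := fun x p => (max ((E₀ - E (x, p)) / c) 0) ^ k
  have hgm : Measurable (fun z : E3 × E3 => gs z.1 z.2) := by
    have : Measurable fun z : E3 × E3 => (max ((E₀ - E z) / c) 0) ^ k :=
      (((measurable_const.sub hEm).div_const c).max measurable_const).pow_const k
    exact this
  have hg0 : ∀ z : E3 × E3, 0 ≤ gs z.1 z.2 := fun z => Real.rpow_nonneg (le_max_right _ _) _
  let S : Set (E3 × E3) := {z | E z < E₀}
  have hS : MeasurableSet S := measurableSet_lt hEm measurable_const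
  have hpS : ∀ z ∈ S, ‖z.2‖ < E₀ := by
    intro z hz
    refine lt_of_le_of_lt ?_ hz
    apply Real.le_sqrt_of_sq_le
    have := Real.exp_pos (2 * φ₀ z.1); linarith
  have hxS : ∀ z ∈ S, -Real.log E₀ < |φ₀ z.1| := by
    intro z hz
    have h1 : Real.exp (φ₀ z.1) < E₀ := by
      refine lt_of_le_of_lt ?_ hz
      apply Real.le_sqrt_of_sq_le
      rw [← Real.exp_nat_mul]; push_cast
      have := sq_nonneg ‖z.2‖; linarith
    have h2 : φ₀ z.1 < Real.log E₀ := (Real.lt_log_iff_exp_lt hE00).2 h1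
    have := neg_abs_le (φ₀ z.1)
    linarith
  have hSv : volume S < ⊤ := by
    have hsub : S ⊆ {x : E3 | -Real.log E₀ < |φ₀ x|} ×ˢ Metric.ball (0 : E3) E₀ := by
      intro z hz
      exact ⟨hxS z hz, by simpa using hpS z hz⟩
    refine lt_of_le_of_lt (measure_mono hsub) ?_
    rw [Measure.volume_eq_prod, Measure.prod_prod]
    exact ENNReal.mul_lt_top (hφ.2.2 _ (by have := Real.log_neg hE00 hE01; linarith))
      measure_ball_lt_top
  have hgS : ∀ z, z ∉ S → gs z.1 z.2 = 0 := by
    intro z hz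
    have : E₀ ≤ E z := not_lt.1 hz
    have : max ((E₀ - E z) / c) 0 = 0 := max_eq_right
      (div_nonpos_of_nonpos_of_nonneg (by linarith) hcpos.le)
    change (max ((E₀ - E z) / c) 0) ^ k = 0
    rw [this, Real.zero_rpow hk.ne']
  have hgB : ∀ z : E3 × E3, gs z.1 z.2 ≤ (E₀ / c) ^ k := by
    intro z
    refine Real.rpow_le_rpow (le_max_right _ _) (max_le ?_ (by positivity)) hk.le
    have := (hEpos z).le
    exact div_le_div_of_nonneg_right (by linarith [hEpos z]) hcpos.le
  set B := (E₀ / c) ^ k with hB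
  have hgi : Integrable (fun z : E3 × E3 => gs z.1 z.2) :=
    integrable_bdd S hS hSv _ hgm B (fun z _ => by rw [abs_of_nonneg (hg0 z)]; exact hgB z) hgS
  have hgNi : Integrable (fun z : E3 × E3 => gs z.1 z.2 ^ (1 + 1/k)) := by
    refine integrable_bdd S hS hSv _ (hgm.pow_const _) (B ^ (1 + 1/k)) (fun z _ => ?_) ?_
    · rw [abs_of_nonneg (Real.rpow_nonneg (hg0 z) _)]
      exact Real.rpow_le_rpow (hg0 z) (hgB z) hq.le
    · intro z hz; rw [hgS z hz, Real.zero_rpow hq.ne']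
  have hgKi : Integrable (fun z : E3 × E3 => E z * gs z.1 z.2) := by
    refine integrable_bdd S hS hSv _ (hEm.mul hgm) (E₀ * B) (fun z hz => ?_) ?_
    · rw [abs_of_nonneg (mul_nonneg (hEpos z).le (hg0 z))]
      exact mul_le_mul (le_of_lt hz) (hgB z) (hg0 z) hE00.le
    · intro z hz; rw [hgS z hz, mul_zero]
  have hgkin : ∫⁻ z : E3 × E3, ENNReal.ofReal (Real.sqrt (1 + ‖z.2‖ ^ 2) * gs z.1 z.2) < ⊤ := by
    have : Integrable (fun z : E3 × E3 => Real.sqrt (1 + ‖z.2‖ ^ 2) * gs z.1 z.2) := by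
      have hm1 : Measurable fun z : E3 × E3 => Real.sqrt (1 + ‖z.2‖ ^ 2) := by fun_prop
      refine integrable_bdd S hS hSv _ (hm1.mul hgm) (2 * B) (fun z hz => ?_) ?_
      · rw [abs_of_nonneg (mul_nonneg (Real.sqrt_nonneg _) (hg0 z))]
        refine mul_le_mul ?_ (hgB z) (hg0 z) (by norm_num)
        rw [Real.sqrt_le_left (by norm_num)]
        have := hpS z hz
        nlinarith [norm_nonneg z.2]
      · intro z hz; rw [hgS z hz, mul_zero]
    have h2 := this.2
    rwa [hasFiniteIntegral_iff_ofReal (Eventually.of_forall fun z =>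
      mul_nonneg (Real.sqrt_nonneg _) (hg0 z))] at h2
  have hcq : c / (1 + 1/k) = k / 6 * G / J ^ (1 + 1/k) := by
    rw [hc']; field_simp
  have hms0 : 0 ≤ ∫ z : E3 × E3, gs z.1 z.2 := integral_nonneg hg0
  have hNs0 : 0 ≤ ∫ z : E3 × E3, gs z.1 z.2 ^ (1 + 1/k) :=
    integral_nonneg fun z => Real.rpow_nonneg (hg0 z) _
  have hKs0 : 0 ≤ ∫ z : E3 × E3, E z * gs z.1 z.2 :=
    integral_nonneg fun z => mul_nonneg (hEpos z).le (hg0 z)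
  -- upper bound for the value at f₀
  have hPhi0 : K + c / (1 + 1/k) * (∫ z : E3 × E3, f₀ z.1 z.2 ^ (1 + 1/k)) - E₀ * M ≤ - (G / 6) := by
    have : c / (1 + 1/k) * (∫ z : E3 × E3, f₀ z.1 z.2 ^ (1 + 1/k)) ≤ k / 6 * G := by
      calc _ ≤ c / (1 + 1/k) * J ^ (1 + 1/k) :=
            mul_le_mul_of_nonneg_left hNint (by positivity)
        _ = _ := by rw [hcq]; field_simp
    rw [hE0M, hI]; linarith
  -- lower bound for the value at the competitor
  have hPhis : - (G / 6) ≤ (∫ z : E3 × E3, E z * gs z.1 z.2)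
      + c / (1 + 1/k) * (∫ z : E3 × E3, gs z.1 z.2 ^ (1 + 1/k))
      - E₀ * ∫ z : E3 × E3, gs z.1 z.2 := by
    rcases hms0.lt_or_eq with hms | hms
    · have hNs : 0 < ∫ z : E3 × E3, gs z.1 z.2 ^ (1 + 1/k) := by
        rcases hNs0.lt_or_eq with h | h
        · exact h
        · exfalso
          have hz := (integral_eq_zero_iff_of_nonneg
            (fun z => Real.rpow_nonneg (hg0 z) _) hgNi).1 h.symm
          have : ∫ z : E3 × E3, gs z.1 z.2 = 0 := by
            rw [← integral_zero (E3 × E3) ℝ]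
            apply integral_congr_ae
            filter_upwards [hz] with z hz
            exact (Real.rpow_eq_zero (hg0 z) hq.ne').1 hz
          linarith
      set ms := ∫ z : E3 × E3, gs z.1 z.2 with hmsdef
      set Ns := ∫ z : E3 × E3, gs z.1 z.2 ^ (1 + 1/k) with hNsdef
      set Ks := ∫ z : E3 × E3, E z * gs z.1 z.2 with hKsdef
      have hu : 0 < ms / M := by positivity
      have hv : 0 < Ns / J ^ (1 + 1/k) := by positivity
      obtain ⟨l, hl, hl1, hl2⟩ := lambda_choice k _ _ hk hk2 hu hv
      have hbound := scaled_real k M J hk hJ gs φ₀ hgm (Eventually.of_forall hg0) hφ hgkin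
        (l^3 / (ms / M)) l 1 (by positivity) hl one_pos hgi hgNi
        (by simpa only [inv_one, one_mul] using hgKi)
        (by rw [← hmsdef]; field_simp)
        (by
          rw [← hNsdef]
          have : Ns = Ns / J ^ (1 + 1/k) * J ^ (1 + 1/k) := by field_simp
          rw [this, one_pow, inv_one, mul_one, ← mul_assoc, hl1, one_mul])
      have hKs' : ∫ z : E3 × E3, Real.sqrt (Real.exp (2 * φ₀ z.1) + ((1:ℝ)⁻¹ * ‖z.2‖) ^ 2) * gs z.1 z.2
          = Ks := by simp only [inv_one, one_mul, hKsdef, hE]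
      rw [hKs', ← hG, ← hIdef] at hbound
      set u := ms / M with hudef
      set v := Ns / J ^ (1 + 1/k) with hvdef
      have hb2 : u * I ≤ Ks + (u * l⁻¹) * (G / 2) := by
        have := mul_le_mul_of_nonneg_left hbound hu.le
        refine this.trans (le_of_eq ?_)
        field_simp
      have hb3 := mul_le_mul_of_nonneg_right hl2 (show 0 ≤ G / 2 by positivity)
      have e1 : c / (1 + 1/k) * Ns = k / 6 * G * v := by rw [hcq, hvdef]; ring
      have e2 : E₀ * ms = u * (E₀ * M) := by rw [hudef]; field_simp
      rw [e1, e2, hE0M]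
      clear_value u v Ks G I
      linarith only [hb2, hb3]
    · rw [← hms]
      have : 0 ≤ c / (1 + 1/k) * (∫ z : E3 × E3, gs z.1 z.2 ^ (1 + 1/k)) := by positivity
      linarith
  -- comparison
  have hpsi0 : Integrable (fun z : E3 × E3 => (E z - E₀) * f₀ z.1 z.2
      + c / (1 + 1/k) * f₀ z.1 z.2 ^ (1 + 1/k)) := by
    have := (hKi.sub (hfi.const_mul E₀)).add (hNi.const_mul (c / (1 + 1/k)))
    refine this.congr (Eventually.of_forall fun z => ?_)
    simp only [Pi.sub_apply, Pi.add_apply]; ring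
  have hpsis : Integrable (fun z : E3 × E3 => (E z - E₀) * gs z.1 z.2
      + c / (1 + 1/k) * gs z.1 z.2 ^ (1 + 1/k)) := by
    have := (hgKi.sub (hgi.const_mul E₀)).add (hgNi.const_mul (c / (1 + 1/k)))
    refine this.congr (Eventually.of_forall fun z => ?_)
    simp only [Pi.sub_apply, Pi.add_apply]; ring
  have hval0 : ∫ z : E3 × E3, ((E z - E₀) * f₀ z.1 z.2
      + c / (1 + 1/k) * f₀ z.1 z.2 ^ (1 + 1/k))
      = K + c / (1 + 1/k) * (∫ z : E3 × E3, f₀ z.1 z.2 ^ (1 + 1/k)) - E₀ * M := by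
    rw [← hfint, hK]
    exact integral_split E (fun z => f₀ z.1 z.2) (fun z => f₀ z.1 z.2 ^ (1 + 1/k)) E₀ _ hKi hfi hNi
  have hvals : ∫ z : E3 × E3, ((E z - E₀) * gs z.1 z.2
      + c / (1 + 1/k) * gs z.1 z.2 ^ (1 + 1/k))
      = (∫ z : E3 × E3, E z * gs z.1 z.2)
      + c / (1 + 1/k) * (∫ z : E3 × E3, gs z.1 z.2 ^ (1 + 1/k))
      - E₀ * ∫ z : E3 × E3, gs z.1 z.2 := by
    exact integral_split E (fun z => gs z.1 z.2) (fun z => gs z.1 z.2 ^ (1 + 1/k)) E₀ _ hgKi hgi hgNi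
  have hstrict : ∀ z : E3 × E3, 0 ≤ f₀ z.1 z.2 → f₀ z.1 z.2 ≠ gs z.1 z.2 →
      (E z - E₀) * gs z.1 z.2 + c / (1 + 1/k) * gs z.1 z.2 ^ (1 + 1/k)
      < (E z - E₀) * f₀ z.1 z.2 + c / (1 + 1/k) * f₀ z.1 z.2 ^ (1 + 1/k) := by
    intro z hz hne
    have hgz : gs z.1 z.2 = (max (-(E z - E₀) / c) 0) ^ k := by rw [neg_sub]
    rw [hgz] at hne ⊢
    exact psi_min k c (E z - E₀) _ hk hcpos hz hne
  have hnn : 0 ≤ᵐ[volume] (fun z : E3 × E3 => ((E z - E₀) * f₀ z.1 z.2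
      + c / (1 + 1/k) * f₀ z.1 z.2 ^ (1 + 1/k)) - ((E z - E₀) * gs z.1 z.2
      + c / (1 + 1/k) * gs z.1 z.2 ^ (1 + 1/k))) := by
    filter_upwards [hf0] with z hz
    apply sub_nonneg.2
    by_cases h : f₀ z.1 z.2 = gs z.1 z.2
    · rw [h]
    · exact (hstrict z hz h).le
  have hint0 : ∫ z : E3 × E3, (((E z - E₀) * f₀ z.1 z.2
      + c / (1 + 1/k) * f₀ z.1 z.2 ^ (1 + 1/k)) - ((E z - E₀) * gs z.1 z.2
      + c / (1 + 1/k) * gs z.1 z.2 ^ (1 + 1/k))) = 0 := by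
    apply le_antisymm _ (integral_nonneg_of_ae hnn)
    rw [integral_sub hpsi0 hpsis, hval0, hvals]
    linarith
  have hfin := (integral_eq_zero_iff_of_nonneg_ae hnn (hpsi0.sub hpsis)).1 hint0
  filter_upwards [hfin, hf0] with z hz hz0
  by_contra hne
  have h1 := hstrict z hz0 hne
  have h2 := sub_eq_zero.1 hz
  linarith
end
end
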